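/- For every s ∈ ℂ and every t ∈ ℂ with t ≠ 0, the polynomial g = x⁴ + s·z⁴ + z²·w + z·w³ − t·w⁴ ∈ ℂ[x,z,w] has local Milnor number 15 at the origin: dim_ℂ O/J(g)·O = 15, where O = ℂ[x,z,w]_{(x,z,w)} is the localization of ℂ[x,z,w] at the maximal ideal of the origin and J(g) is the Jacobian ideal of g. (This is the generic A₃ ⊕ D₅ singularity, with μ = 3·5 = 15, of the compactified fibres 𝕐_{s,t}, t ≠ 0, at the point [0:1:0:0] in the paper's Example 8.5, computed in the affine chart Y = 1 of the homogenization of x⁴ + sz⁴ + z²y + z.) -/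

import Mathlib

open MvPolynomial

noncomputable section

/-- The maximal ideal of the origin in ℂ[x,z,w] (variables: X 0 = x, X 1 = z, X 2 = w),
    realized as the kernel of evaluation at 0. -/
def mOrigin₃ : Ideal (MvPolynomial (Fin 3) ℂ) := RingHom.ker (eval (0 : Fin 3 → ℂ))

instance : mOrigin₃.IsMaximal :=
  RingHom.ker_isMaximal_of_surjective _ (fun r => ⟨C r, by simp⟩)

/-- g = x⁴ + s·z⁴ + z²·w + z·w³ − t·w⁴ (variables: X 0 = x, X 1 = z, X 2 = w). -/
def g₈₅ (s t : ℂ) : MvPolynomial (Fin 3) ℂ :=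
  X 0 ^ 4 + C s * X 1 ^ 4 + X 1 ^ 2 * X 2 + X 1 * X 2 ^ 3 - C t * X 2 ^ 4

/-- for every s ∈ ℂ and t ≠ 0, g = x⁴ + sz⁴ + z²w + zw³ − tw⁴ has local
    Milnor number 15 at the origin: dim_ℂ O/J(g)·O = 15 (the generic A₃ ⊕ D₅
    singularity of the fibres 𝕐_{s,t}, t ≠ 0, in Example 8.5). -/
theorem finrank_localization_quotient_of_le_radical {k R : Type*} [Field k] [CommRing R]
    [Algebra k R] (m I : Ideal R) [m.IsMaximal] (h : m ≤ I.radical) :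
    Module.finrank k (Localization.AtPrime m ⧸
      I.map (algebraMap R (Localization.AtPrime m))) = Module.finrank k (R ⧸ I) := by
  have hu : Algebra.algebraMapSubmonoid (R ⧸ I) m.primeCompl ≤ IsUnit.submonoid (R ⧸ I) := by
    rintro _ ⟨s, hs, rfl⟩
    obtain ⟨a, b, hb, hab⟩ := Ideal.IsMaximal.exists_inv (I := m) inferInstance hs
    have hnil : IsNilpotent (algebraMap R (R ⧸ I) b) := by
      obtain ⟨n, hn⟩ := h hb
      refine ⟨n, ?_⟩
      rw [← map_pow]
      exact Ideal.Quotient.eq_zero_iff_mem.2 hn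
    have h1 : algebraMap R (R ⧸ I) a * algebraMap R (R ⧸ I) s =
        1 - algebraMap R (R ⧸ I) b := by
      rw [← map_mul, ← map_one (algebraMap R (R ⧸ I)), ← map_sub, ← hab, add_sub_cancel_right]
    exact isUnit_of_mul_isUnit_right (h1 ▸ hnil.isUnit_one_sub)
  let e := IsLocalization.atUnits (R ⧸ I) (Algebra.algebraMapSubmonoid (R ⧸ I) m.primeCompl)
    (S := Localization.AtPrime m ⧸ I.map (algebraMap R (Localization.AtPrime m))) hu
  exact (LinearEquiv.finrank_eq
    { e.toAddEquiv with
      map_smul' := fun c x => by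
        have he (r : R) : e (Ideal.Quotient.mk I r) = Ideal.Quotient.mk _ (algebraMap R _ r) :=
          e.commutes _
        obtain ⟨r, rfl⟩ := Ideal.Quotient.mk_surjective x
        change e (Ideal.Quotient.mk I (c • r)) = c • e (Ideal.Quotient.mk I r)
        rw [he, he, Algebra.smul_def, map_mul, ← IsScalarTower.algebraMap_apply,
          ← Algebra.smul_def]
        rfl }).symm

/-- The ideal `(x³, 2zw + w³, z² - 4tw³, w⁴)`, which generates the same ideal as the Jacobian
ideal of `g₈₅ s t` in the local ring of the origin when `t ≠ 0`. -/
def reducedJacobian (t : ℂ) : Ideal (MvPolynomial (Fin 3) ℂ) :=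
  Ideal.span {X 0 ^ 3, 2 * X 1 * X 2 + X 2 ^ 3, X 1 ^ 2 - C (4 * t) * X 2 ^ 3, X 2 ^ 4}

theorem X_zero_pow_three_mem (t : ℂ) : X 0 ^ 3 ∈ reducedJacobian t :=
  Ideal.subset_span (by simp)

theorem two_mul_X_one_mul_X_two_add_mem (t : ℂ) : 2 * X 1 * X 2 + X 2 ^ 3 ∈ reducedJacobian t :=
  Ideal.subset_span (by simp)

theorem X_one_sq_sub_mem (t : ℂ) : X 1 ^ 2 - C (4 * t) * X 2 ^ 3 ∈ reducedJacobian t :=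
  Ideal.subset_span (by simp)

theorem X_two_pow_four_mem (t : ℂ) : X 2 ^ 4 ∈ reducedJacobian t :=
  Ideal.subset_span (by simp)

theorem C_half_mul_two : (C (1 / 2) * 2 : MvPolynomial (Fin 3) ℂ) = 1 := by
  rw [← map_ofNat C 2, ← C_mul]; norm_num

theorem X_one_mul_X_two_sq_mem (t : ℂ) : X 1 * X 2 ^ 2 ∈ reducedJacobian t := by
  have h := Ideal.mul_mem_left _ (C (1 / 2)) (sub_mem
    (Ideal.mul_mem_left _ (X 2) (two_mul_X_one_mul_X_two_add_mem t)) (X_two_pow_four_mem t))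
  convert h using 1
  linear_combination (-X 1 * X 2 ^ 2 : MvPolynomial (Fin 3) ℂ) * C_half_mul_two

theorem X_one_pow_three_mem (t : ℂ) : X 1 ^ 3 ∈ reducedJacobian t := by
  have h := add_mem (Ideal.mul_mem_left _ (X 1) (X_one_sq_sub_mem t))
    (Ideal.mul_mem_left _ (C (4 * t) * X 2) (X_one_mul_X_two_sq_mem t))
  convert h using 1
  ring

theorem X_one_sq_mul_X_two_mem (t : ℂ) : X 1 ^ 2 * X 2 ∈ reducedJacobian t := by
  have h := add_mem (Ideal.mul_mem_left _ (X 2) (X_one_sq_sub_mem t))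
    (Ideal.mul_mem_left _ (C (4 * t)) (X_two_pow_four_mem t))
  convert h using 1
  ring

theorem X_mem_mOrigin₃ (i : Fin 3) : X i ∈ mOrigin₃ := by
  simp [mOrigin₃, RingHom.mem_ker]

theorem mOrigin₃_le_span : mOrigin₃ ≤ Ideal.span (Set.range X) := by
  intro p hp
  rw [← Set.image_univ, mem_ideal_span_X_image]
  intro m hm
  by_contra! h
  have h0 : m = 0 := by ext i; simpa using h i
  rw [mem_support_iff, h0, ← constantCoeff_eq] at hm
  apply hm
  rwa [mOrigin₃, RingHom.mem_ker, eval_zero] at hp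

theorem mOrigin₃_le_radical (t : ℂ) : mOrigin₃ ≤ (reducedJacobian t).radical := by
  refine mOrigin₃_le_span.trans (Ideal.span_le.2 ?_)
  rintro _ ⟨i, rfl⟩
  fin_cases i
  · exact ⟨3, X_zero_pow_three_mem t⟩
  · exact ⟨3, X_one_pow_three_mem t⟩
  · exact ⟨4, X_two_pow_four_mem t⟩

theorem pderiv_zero_g₈₅ (s t : ℂ) : pderiv 0 (g₈₅ s t) = 4 * X 0 ^ 3 := by
  simp [g₈₅, pderiv_X]

theorem pderiv_one_g₈₅ (s t : ℂ) :
    pderiv 1 (g₈₅ s t) = 4 * C s * X 1 ^ 3 + 2 * X 1 * X 2 + X 2 ^ 3 := by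
  simp [g₈₅, pderiv_X]
  ring

theorem pderiv_two_g₈₅ (s t : ℂ) :
    pderiv 2 (g₈₅ s t) = X 1 ^ 2 + 3 * X 1 * X 2 ^ 2 - 4 * C t * X 2 ^ 3 := by
  simp [g₈₅, pderiv_X]
  ring

theorem jacobian_le_reducedJacobian (s t : ℂ) :
    Ideal.span {pderiv 0 (g₈₅ s t), pderiv 1 (g₈₅ s t), pderiv 2 (g₈₅ s t)} ≤
      reducedJacobian t := by
  rw [pderiv_zero_g₈₅, pderiv_one_g₈₅, pderiv_two_g₈₅, Ideal.span_le]
  rintro _ (rfl | rfl | rfl)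
  · exact Ideal.mul_mem_left _ _ (X_zero_pow_three_mem t)
  · have h := add_mem (Ideal.mul_mem_left _ (4 * C s) (X_one_pow_three_mem t))
      (two_mul_X_one_mul_X_two_add_mem t)
    rwa [← add_assoc] at h
  · have h := add_mem (Ideal.mul_mem_left _ 3 (X_one_mul_X_two_sq_mem t)) (X_one_sq_sub_mem t)
    rw [SetLike.mem_coe]
    convert h using 1
    simp only [C_mul, map_ofNat]
    ring

theorem reducedJacobian_le_sup (s t : ℂ) (ht : t ≠ 0) :
    reducedJacobian t ≤
      Ideal.span {pderiv 0 (g₈₅ s t), pderiv 1 (g₈₅ s t), pderiv 2 (g₈₅ s t)} ⊔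
        mOrigin₃ * reducedJacobian t := by
  rw [pderiv_zero_g₈₅, pderiv_one_g₈₅, pderiv_two_g₈₅]
  set J : Ideal (MvPolynomial (Fin 3) ℂ) := Ideal.span _
  set K := J ⊔ mOrigin₃ * reducedJacobian t
  have hJ : J ≤ K := le_sup_left
  have hm (i : Fin 3) {p} (hp : p ∈ reducedJacobian t) : X i * p ∈ K :=
    (le_sup_right : _ ≤ K) (Ideal.mul_mem_mul (X_mem_mOrigin₃ i) hp)
  have h0 : 4 * X 0 ^ 3 ∈ K := hJ (Ideal.subset_span (by simp))
  have h1 : 4 * C s * X 1 ^ 3 + 2 * X 1 * X 2 + X 2 ^ 3 ∈ K :=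
    hJ (Ideal.subset_span (by simp))
  have h2 : X 1 ^ 2 + 3 * X 1 * X 2 ^ 2 - 4 * C t * X 2 ^ 3 ∈ K :=
    hJ (Ideal.subset_span (by simp))
  have hzzz : X 1 ^ 3 ∈ K := by
    have h := add_mem (hm 1 (X_one_sq_sub_mem t))
      (Ideal.mul_mem_left _ (C (4 * t)) (hm 2 (X_one_mul_X_two_sq_mem t)))
    convert h using 1
    ring
  have hw : X 2 ^ 4 ∈ K := by
    have h := Ideal.mul_mem_left _ (C (1 / (8 * t))) (add_mem (sub_mem (sub_mem
      (Ideal.mul_mem_left _ (X 1) h1) (Ideal.mul_mem_left _ (2 * X 2) h2))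
      (Ideal.mul_mem_left _ (4 * C s) (hm 1 (X_one_pow_three_mem t))))
      (Ideal.mul_mem_left _ 5 (hm 2 (X_one_mul_X_two_sq_mem t))))
    have hc : (C (1 / (8 * t)) * (8 * C t) : MvPolynomial (Fin 3) ℂ) = 1 := by
      rw [← map_ofNat C 8, ← C_mul, ← C_mul, one_div_mul_cancel (by simpa using ht), C_1]
    convert h using 1
    linear_combination (-X 2 ^ 4 : MvPolynomial (Fin 3) ℂ) * hc
  have hzww : X 1 * X 2 ^ 2 ∈ K := by
    have h := Ideal.mul_mem_left _ (C (1 / 2)) (sub_mem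
      (hm 2 (two_mul_X_one_mul_X_two_add_mem t)) hw)
    convert h using 1
    linear_combination (-X 1 * X 2 ^ 2 : MvPolynomial (Fin 3) ℂ) * C_half_mul_two
  refine Ideal.span_le.2 ?_
  rintro _ (rfl | rfl | rfl | rfl)
  · have h := Ideal.mul_mem_left _ (C (1 / 4)) h0
    have hc : (C (1 / 4) * 4 : MvPolynomial (Fin 3) ℂ) = 1 := by
      rw [← map_ofNat C 4, ← C_mul]; norm_num
    rwa [← mul_assoc, hc, one_mul] at h
  · have h := sub_mem h1 (Ideal.mul_mem_left _ (4 * C s) hzzz)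
    rw [SetLike.mem_coe]
    convert h using 1
    ring
  · have h := sub_mem h2 (Ideal.mul_mem_left _ 3 hzww)
    rw [SetLike.mem_coe]
    convert h using 1
    simp only [C_mul, map_ofNat]
    ring
  · exact hw

theorem map_jacobian_eq (s t : ℂ) (ht : t ≠ 0) :
    Ideal.map (algebraMap (MvPolynomial (Fin 3) ℂ) (Localization.AtPrime mOrigin₃))
      (Ideal.span {pderiv 0 (g₈₅ s t), pderiv 1 (g₈₅ s t), pderiv 2 (g₈₅ s t)}) =
    Ideal.map (algebraMap (MvPolynomial (Fin 3) ℂ) (Localization.AtPrime mOrigin₃))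
      (reducedJacobian t) := by
  refine le_antisymm (Ideal.map_mono (jacobian_le_reducedJacobian s t)) ?_
  refine Submodule.le_of_le_smul_of_le_jacobson_bot (IsNoetherian.noetherian _)
    (IsLocalRing.maximalIdeal_le_jacobson ⊥) ?_
  rw [smul_eq_mul, ← Localization.AtPrime.map_eq_maximalIdeal, ← Ideal.map_mul, ← Ideal.map_sup]
  exact Ideal.map_mono (reducedJacobian_le_sup s t ht)

/-- The coordinates of `z ^ j * w ^ k` in the basis `1, w, w², w³, z` of
`ℂ[z, w] / (2zw + w³, z² - 4tw³, w⁴)`. -/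
def normalForm (t : ℂ) : ℕ → ℕ → Fin 5 → ℂ
  | 0, 0 => Pi.single 0 1
  | 0, 1 => Pi.single 1 1
  | 0, 2 => Pi.single 2 1
  | 0, 3 => Pi.single 3 1
  | 1, 0 => Pi.single 4 1
  | 1, 1 => Pi.single 3 (-1 / 2)
  | 2, 0 => Pi.single 3 (4 * t)
  | _, _ => 0

/-- The coordinates of a polynomial modulo `reducedJacobian t` in the basis
`xⁱ, xⁱw, xⁱw², xⁱw³, xⁱz` for `i < 3`. -/
def coordinates (t : ℂ) : MvPolynomial (Fin 3) ℂ →ₗ[ℂ] Fin 3 → Fin 5 → ℂ :=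
  (basisMonomials (Fin 3) ℂ).constr ℂ fun m i =>
    if m 0 = i then normalForm t (m 1) (m 2) else 0

theorem coordinates_monomial (t : ℂ) (i j k : ℕ) :
    coordinates t (X 0 ^ i * X 1 ^ j * X 2 ^ k) =
      fun a : Fin 3 => if i = a then normalForm t j k else 0 := by
  have h : (X 0 ^ i * X 1 ^ j * X 2 ^ k : MvPolynomial (Fin 3) ℂ) =
      basisMonomials (Fin 3) ℂ
        (Finsupp.single 0 i + Finsupp.single 1 j + Finsupp.single 2 k) := by
    simp [X_pow_eq_monomial, monomial_mul]
  rw [h, coordinates, Module.Basis.constr_basis]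
  simp

theorem induction_on_monomials {p : MvPolynomial (Fin 3) ℂ → Prop}
    (hadd : ∀ f g, p f → p g → p (f + g)) (hsmul : ∀ (c : ℂ) f, p f → p (c • f))
    (hX : ∀ i j k, p (X 0 ^ i * X 1 ^ j * X 2 ^ k)) (f : MvPolynomial (Fin 3) ℂ) : p f := by
  induction f using MvPolynomial.induction_on' with
  | monomial m c =>
    convert hsmul c _ (hX (m 0) (m 1) (m 2))
    rw [monomial_eq, smul_eq_C_mul, Finsupp.prod_fintype _ _ (by simp), Fin.prod_univ_three]
  | add f g hf hg => exact hadd f g hf hg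

theorem coordinates_mul_eq_zero_of_mem (t : ℂ) {f : MvPolynomial (Fin 3) ℂ}
    (hf : f ∈ reducedJacobian t) (q : MvPolynomial (Fin 3) ℂ) : coordinates t (q * f) = 0 := by
  induction hf using Submodule.span_induction generalizing q with
  | zero => simp
  | add f g _ _ hf hg => rw [mul_add, map_add, hf, hg, add_zero]
  | smul a f _ hf => rw [smul_eq_mul, ← mul_assoc, hf]
  | mem f hf =>
    induction q using induction_on_monomials with
    | hadd p q hp hq => rw [add_mul, map_add, hp, hq, add_zero]
    | hsmul c p hp => rw [smul_mul_assoc, map_smul, hp, smul_zero]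
    | hX i j k =>
      obtain rfl | rfl | rfl | rfl := hf
      · rw [show (X 0 ^ i * X 1 ^ j * X 2 ^ k * X 0 ^ 3 : MvPolynomial (Fin 3) ℂ) =
          X 0 ^ (i + 3) * X 1 ^ j * X 2 ^ k by ring, coordinates_monomial]
        funext a
        exact if_neg (by omega)
      · rw [show (X 0 ^ i * X 1 ^ j * X 2 ^ k * (2 * X 1 * X 2 + X 2 ^ 3) :
            MvPolynomial (Fin 3) ℂ) = (2 : ℂ) • (X 0 ^ i * X 1 ^ (j + 1) * X 2 ^ (k + 1)) +
            X 0 ^ i * X 1 ^ j * X 2 ^ (k + 3) by rw [smul_eq_C_mul, map_ofNat]; ring,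
          map_add, map_smul, coordinates_monomial, coordinates_monomial]
        have h : (2 : ℂ) • normalForm t (j + 1) (k + 1) + normalForm t j (k + 3) = 0 := by
          match j, k with
          | 0, 0 => norm_num [normalForm, ← Pi.single_smul, ← Pi.single_add]
          | 0, k + 1 => simp [normalForm]
          | 1, k => simp [normalForm]
          | j + 2, k => simp [normalForm]
        funext a
        by_cases ha : i = a <;> simp [ha, h]
      · rw [show (X 0 ^ i * X 1 ^ j * X 2 ^ k * (X 1 ^ 2 - C (4 * t) * X 2 ^ 3) :
            MvPolynomial (Fin 3) ℂ) = X 0 ^ i * X 1 ^ (j + 2) * X 2 ^ k -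
            (4 * t) • (X 0 ^ i * X 1 ^ j * X 2 ^ (k + 3)) by rw [smul_eq_C_mul]; ring,
          map_sub, map_smul, coordinates_monomial, coordinates_monomial]
        have h : normalForm t (j + 2) k - (4 * t) • normalForm t j (k + 3) = 0 := by
          match j, k with
          | 0, 0 => simp [normalForm, ← Pi.single_smul]
          | 0, k + 1 => simp [normalForm]
          | 1, k => simp [normalForm]
          | j + 2, k => simp [normalForm]
        funext a
        by_cases ha : i = a <;> simp [ha, h]
      · rw [show (X 0 ^ i * X 1 ^ j * X 2 ^ k * X 2 ^ 4 : MvPolynomial (Fin 3) ℂ) =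
          X 0 ^ i * X 1 ^ j * X 2 ^ (k + 4) by ring, coordinates_monomial]
        have h : normalForm t j (k + 4) = 0 := by
          match j with
          | 0 => simp [normalForm]
          | 1 => simp [normalForm]
          | j + 2 => simp [normalForm]
        funext a
        simp [h]

/-- The polynomial with given coordinates in the basis of the quotient by `reducedJacobian t`. -/
def ofCoordinates : (Fin 3 → Fin 5 → ℂ) →ₗ[ℂ] MvPolynomial (Fin 3) ℂ :=
  ∑ i : Fin 3, ∑ b : Fin 5, LinearMap.toSpanSingleton ℂ _
    (X 0 ^ (i : ℕ) * ![1, X 2, X 2 ^ 2, X 2 ^ 3, X 1] b) ∘ₗ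
      LinearMap.proj b ∘ₗ LinearMap.proj i

theorem coordinates_ofCoordinates (t : ℂ) (v : Fin 3 → Fin 5 → ℂ) :
    coordinates t (ofCoordinates v) = v := by
  have h (i : Fin 3) (b : Fin 5) : coordinates t
      (X 0 ^ (i : ℕ) * ![1, X 2, X 2 ^ 2, X 2 ^ 3, X 1] b) = Pi.single i (Pi.single b 1) := by
    have h (j k : ℕ) (hjk : normalForm t j k = Pi.single b 1) :
        coordinates t (X 0 ^ (i : ℕ) * X 1 ^ j * X 2 ^ k) = Pi.single i (Pi.single b 1) := by
      rw [coordinates_monomial, hjk]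
      funext a
      by_cases ha : i = a
      · subst ha; simp
      · simp [Fin.val_inj, ha]
    fin_cases b
    · simpa using h 0 0 rfl
    · simpa using h 0 1 rfl
    · simpa using h 0 2 rfl
    · simpa using h 0 3 rfl
    · simpa using h 1 0 rfl
  simp only [ofCoordinates, LinearMap.sum_apply, LinearMap.comp_apply, LinearMap.proj_apply,
    LinearMap.toSpanSingleton_apply, map_sum, map_smul, h]
  funext a b
  simp [Finset.sum_apply, Pi.single_apply, ite_apply]

theorem sub_ofCoordinates_mem (t : ℂ) (f : MvPolynomial (Fin 3) ℂ) :
    f - ofCoordinates (coordinates t f) ∈ reducedJacobian t := by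
  induction f using induction_on_monomials with
  | hadd f g hf hg =>
    rw [map_add, map_add, add_sub_add_comm]
    exact add_mem hf hg
  | hsmul c f hf =>
    rw [map_smul, map_smul, ← smul_sub]
    exact Submodule.smul_of_tower_mem _ c hf
  | hX i j k =>
    rw [coordinates_monomial]
    by_cases hi : i < 3
    · lift i to Fin 3 using hi
      have h : X 1 ^ j * X 2 ^ k - ∑ b, normalForm t j k b •
          (![1, X 2, X 2 ^ 2, X 2 ^ 3, X 1] b : MvPolynomial (Fin 3) ℂ) ∈ reducedJacobian t := by
        rw [Fin.sum_univ_five]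
        match j, k with
        | 0, 0 => simp [normalForm]
        | 0, 1 => simp [normalForm]
        | 0, 2 => simp [normalForm]
        | 0, 3 => simp [normalForm]
        | 0, k + 4 =>
          simpa [normalForm, pow_add] using Ideal.mul_mem_left _ (X 2 ^ k) (X_two_pow_four_mem t)
        | 1, 0 => simp [normalForm]
        | 1, 1 =>
          have h := Ideal.mul_mem_left _ (C (1 / 2)) (two_mul_X_one_mul_X_two_add_mem t)
          have hc : (C (-1 / 2) : MvPolynomial (Fin 3) ℂ) = -C (1 / 2) := by
            rw [← C_neg, neg_div]
          convert h using 1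
          simp only [normalForm, smul_eq_C_mul, Pi.single_apply]
          simp [hc, -one_div]
          linear_combination (-X 1 * X 2 : MvPolynomial (Fin 3) ℂ) * C_half_mul_two
        | 1, k + 2 =>
          have h := Ideal.mul_mem_left _ (X 2 ^ k) (X_one_mul_X_two_sq_mem t)
          simp [normalForm]
          convert h using 1
          ring
        | 2, 0 => simpa [normalForm, smul_eq_C_mul] using X_one_sq_sub_mem t
        | 2, k + 1 =>
          have h := Ideal.mul_mem_left _ (X 2 ^ k) (X_one_sq_mul_X_two_mem t)
          simp [normalForm]
          convert h using 1
          ring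
        | j + 3, k =>
          have h := Ideal.mul_mem_left _ (X 1 ^ j * X 2 ^ k) (X_one_pow_three_mem t)
          simp [normalForm]
          convert h using 1
          ring
      convert Ideal.mul_mem_left _ (X 0 ^ (i : ℕ)) h using 1
      simp only [ofCoordinates, LinearMap.sum_apply, LinearMap.comp_apply, LinearMap.proj_apply,
        LinearMap.toSpanSingleton_apply, mul_sub, mul_assoc, Finset.mul_sum, mul_smul_comm,
        Fin.val_inj]
      rw [Finset.sum_eq_single i (fun a _ ha => by simp [ha.symm]) (by simp)]
      simp
    · have h0 : (fun a : Fin 3 => if i = a then normalForm t j k else 0) = 0 :=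
        funext fun a => if_neg (by omega)
      obtain ⟨l, rfl⟩ := Nat.exists_eq_add_of_le (not_lt.1 hi)
      rw [h0, map_zero, sub_zero, pow_add, mul_assoc, mul_assoc]
      exact Ideal.mul_mem_right _ _ (X_zero_pow_three_mem t)

theorem ker_coordinates (t : ℂ) :
    LinearMap.ker (coordinates t) = (reducedJacobian t).restrictScalars ℂ := by
  ext f
  refine ⟨fun hf => ?_, fun hf => ?_⟩
  · simpa [LinearMap.mem_ker.1 hf] using sub_ofCoordinates_mem t f
  · simpa using coordinates_mul_eq_zero_of_mem t hf 1

theorem finrank_quotient_reducedJacobian (t : ℂ) :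
    Module.finrank ℂ (MvPolynomial (Fin 3) ℂ ⧸ reducedJacobian t) = 15 := by
  have hs : Function.Surjective (coordinates t) :=
    fun v => ⟨ofCoordinates v, coordinates_ofCoordinates t v⟩
  let e := (Submodule.Quotient.restrictScalarsEquiv ℂ (reducedJacobian t)).symm ≪≫ₗ
    Submodule.quotEquivOfEq _ _ (ker_coordinates t).symm ≪≫ₗ
    (coordinates t).quotKerEquivOfSurjective hs
  rw [e.finrank_eq, Module.finrank_pi_fintype]
  simp

theorem local_milnor_number_example85_generic (s t : ℂ) (ht : t ≠ 0) :
    Module.finrank ℂ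
      (Localization.AtPrime mOrigin₃ ⧸
        Ideal.map (algebraMap (MvPolynomial (Fin 3) ℂ) (Localization.AtPrime mOrigin₃))
          (Ideal.span {pderiv 0 (g₈₅ s t), pderiv 1 (g₈₅ s t), pderiv 2 (g₈₅ s t)}))
      = 15 := by
  rw [map_jacobian_eq s t ht, finrank_localization_quotient_of_le_radical _ _ (mOrigin₃_le_radical t),
    finrank_quotient_reducedJacobian]
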